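/- Let k ≥ 2 be an integer and let T be a finite tree with 2k−3 ≤ diam(T) ≤ 2k−2. Then c_{H,k}(T) ≤ 3. -/

import Mathlib

namespace CopsRobber

open SimpleGraph

/-- A strategy for `d` cops on vertex set `V`: initial positions, together with a move
function taking the list of observations made so far (most recent first; the observation in a
round is `some r` if the robber, located at `r`, was visible to the cops at the start of that
round, and `none` if he was invisible) and the current cop positions, and returning the cops'
new positions. -/
structure CopStrategy (V : Type) (d : ℕ) where
  init : Fin d → V
  move : List (Option V) → (Fin d → V) → Fin d → V

/-- A strategy for the omniscient robber against `d` cops: a starting vertex chosen after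
seeing the cops' initial positions, and a move function which may depend on the entire history
of the game (the list of past (cop positions, robber position) states, most recent first),
the cops' new positions, and the robber's current position. -/
structure RobberStrategy (V : Type) (d : ℕ) where
  init : (Fin d → V) → V
  move : List ((Fin d → V) × V) → (Fin d → V) → V → V

/-- A cop strategy is legal if every cop always stays put or moves along an edge of `G`. -/
def CopStrategy.Legal {V : Type} (G : SimpleGraph V) {d : ℕ} (S : CopStrategy V d) : Prop :=
  ∀ h p i, S.move h p i = p i ∨ G.Adj (p i) (S.move h p i)

/-- A robber strategy is legal if the robber always stays put or moves along an edge of `G`. -/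
def RobberStrategy.Legal {V : Type} (G : SimpleGraph V) {d : ℕ} (R : RobberStrategy V d) :
    Prop :=
  ∀ h c r, R.move h c r = r ∨ G.Adj r (R.move h c r)

open Classical in
/-- The cops' observation: the robber's position if he is visible, `none` otherwise. -/
noncomputable def observe {V : Type} {d : ℕ} (vis : (Fin d → V) → V → Prop)
    (c : Fin d → V) (r : V) : Option V :=
  if vis c r then some r else none

/-- The play of the game determined by a cop strategy and a robber strategy, with visibility
predicate `vis`: at each stage we record the current (cop positions, robber position) together
with the list of past observations and the list of past states. In each round the cops observe
the robber (according to `vis`), move, and then the robber moves. -/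
noncomputable def play {V : Type} {d : ℕ} (vis : (Fin d → V) → V → Prop)
    (S : CopStrategy V d) (R : RobberStrategy V d) :
    ℕ → ((Fin d → V) × V) × (List (Option V) × List ((Fin d → V) × V))
  | 0 => ((S.init, R.init S.init), ([], []))
  | n + 1 =>
    let st := play vis S R n
    let c := st.1.1
    let r := st.1.2
    let o := observe vis c r
    let c' := S.move (o :: st.2.1) c
    let r' := R.move ((c, r) :: st.2.2) c' r
    ((c', r'), (o :: st.2.1, (c, r) :: st.2.2))

/-- The cops' positions at the end of round `n`. -/
noncomputable def copPos {V : Type} {d : ℕ} (vis : (Fin d → V) → V → Prop)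
    (S : CopStrategy V d) (R : RobberStrategy V d) (n : ℕ) : Fin d → V :=
  (play vis S R n).1.1

/-- The robber's position at the end of round `n`. -/
noncomputable def robPos {V : Type} {d : ℕ} (vis : (Fin d → V) → V → Prop)
    (S : CopStrategy V d) (R : RobberStrategy V d) (n : ℕ) : V :=
  (play vis S R n).1.2

/-- The cops capture the robber in the given play: at some point (either at the end of a round,
or just after the cops' move within a round) some cop occupies the robber's vertex. -/
def Captures {V : Type} {d : ℕ} (vis : (Fin d → V) → V → Prop)
    (S : CopStrategy V d) (R : RobberStrategy V d) : Prop :=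
  ∃ n i, copPos vis S R n i = robPos vis S R n ∨ copPos vis S R (n + 1) i = robPos vis S R n

/-- A winning strategy for `d` cops on `G` with visibility predicate `vis`: a legal cop
strategy capturing the robber against every legal robber strategy (the robber is omniscient,
so the cops must succeed against all robber behaviours). -/
def WinningCopStrategy {V : Type} (G : SimpleGraph V) {d : ℕ}
    (vis : (Fin d → V) → V → Prop) (S : CopStrategy V d) : Prop :=
  S.Legal G ∧ ∀ R : RobberStrategy V d, R.Legal G → Captures vis S R

/-- The minimum number of cops having a winning strategy on `G`, for the game with visibility
predicate `vis`. -/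
noncomputable def copNumberVis {V : Type} (G : SimpleGraph V)
    (vis : ∀ d : ℕ, (Fin d → V) → V → Prop) : ℕ :=
  sInf {d | ∃ S : CopStrategy V d, WinningCopStrategy G (vis d) S}

/-- The classical cop number `c(G)`: the robber is always visible. -/
noncomputable def copNumber {V : Type} (G : SimpleGraph V) : ℕ :=
  copNumberVis G fun _ _ _ => True

/-- The 0-visibility cop number `c₀(G)`: the robber is never visible. -/
noncomputable def zeroVisCopNumber {V : Type} (G : SimpleGraph V) : ℕ :=
  copNumberVis G fun _ _ _ => False

/-- The `k`-hyperopic cop number `c_{H,k}(G)`: the robber at `r` is invisible exactly when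
every cop `c` satisfies `1 ≤ d(r,c) ≤ k`. -/
noncomputable def hyperopicCopNumber {V : Type} (G : SimpleGraph V) (k : ℕ) : ℕ :=
  copNumberVis G fun _ c r => ¬ ∀ i, 1 ≤ G.dist r (c i) ∧ G.dist r (c i) ≤ k

/-! ### Winning by tracking the set of possible robber positions -/

section Belief

variable {V : Type} {d : ℕ}

/-- The positions an uncaught robber can reach from `A` in the round where the cops move to `c`. -/
def nextPositions (G : SimpleGraph V) (c : Fin d → V) (A : Set V) : Set V :=
  {r' | (∀ i, c i ≠ r') ∧ ∃ r ∈ A, (∀ i, c i ≠ r) ∧ (r' = r ∨ G.Adj r r')}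

/-- The cops, standing at `c` and knowing that the robber is in `B`, can catch him within `n`
rounds. -/
def WinsWithin (G : SimpleGraph V) (vis : (Fin d → V) → V → Prop) :
    ℕ → (Fin d → V) → Set V → Prop
  | 0, _, B => B = ∅
  | n + 1, c, B => ∀ o : Option V, ∃ c' : Fin d → V, (∀ i, c' i = c i ∨ G.Adj (c i) (c' i)) ∧
      WinsWithin G vis n c' (nextPositions G c' {r ∈ B | observe vis c r = o})

/-- The cops, standing at `c` and knowing that the robber is in `B`, can catch him within a
bounded number of rounds. -/
def Wins (G : SimpleGraph V) (vis : (Fin d → V) → V → Prop) (c : Fin d → V) (B : Set V) : Prop :=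
  ∃ n, WinsWithin G vis n c B

variable {G : SimpleGraph V} {vis : (Fin d → V) → V → Prop}

lemma nextPositions_mono {c : Fin d → V} {A B : Set V} (h : A ⊆ B) :
    nextPositions G c A ⊆ nextPositions G c B :=
  fun _ ⟨h₁, r, hr, h₂⟩ ↦ ⟨h₁, r, h hr, h₂⟩

lemma WinsWithin.anti {n : ℕ} : ∀ {c : Fin d → V} {A B : Set V}, A ⊆ B →
    WinsWithin G vis n c B → WinsWithin G vis n c A := by
  induction n with
  | zero => exact fun h hB ↦ Set.subset_empty_iff.1 (hB ▸ h)
  | succ n ih =>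
    intro c A B h hB o
    obtain ⟨c', hc, hw⟩ := hB o
    refine ⟨c', hc, ih (nextPositions_mono ?_) hw⟩
    exact fun r hr ↦ ⟨h hr.1, hr.2⟩

lemma winsWithin_empty (n : ℕ) : ∀ c : Fin d → V, WinsWithin G vis n c ∅ := by
  induction n with
  | zero => exact fun _ ↦ rfl
  | succ n ih =>
    refine fun c o ↦ ⟨c, fun i ↦ .inl rfl, (ih c).anti ?_⟩
    rintro r ⟨-, r', hr', -⟩
    exact hr'.1

lemma WinsWithin.succ {n : ℕ} : ∀ {c : Fin d → V} {B : Set V}, WinsWithin G vis n c B →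
    WinsWithin G vis (n + 1) c B := by
  induction n with
  | zero => rintro c _ rfl; exact winsWithin_empty 1 c
  | succ n ih =>
    intro c B h o
    obtain ⟨c', hc, hw⟩ := h o
    exact ⟨c', hc, ih hw⟩

lemma WinsWithin.mono {m n : ℕ} (hmn : m ≤ n) {c : Fin d → V} {B : Set V}
    (h : WinsWithin G vis m c B) : WinsWithin G vis n c B :=
  Nat.le_induction h (fun _ _ ih ↦ ih.succ) n hmn

lemma Wins.anti {c : Fin d → V} {A B : Set V} (hB : Wins G vis c B) (h : A ⊆ B) :
    Wins G vis c A :=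
  hB.imp fun _ hn ↦ hn.anti h

lemma wins_empty (c : Fin d → V) : Wins G vis c ∅ := ⟨0, rfl⟩

lemma wins_of_forall_observation [Finite V] {c : Fin d → V} {B : Set V}
    (h : ∀ o : Option V, ∃ c' : Fin d → V, (∀ i, c' i = c i ∨ G.Adj (c i) (c' i)) ∧
      Wins G vis c' (nextPositions G c' {r ∈ B | observe vis c r = o})) :
    Wins G vis c B := by
  choose f hf n hn using h
  have := Fintype.ofFinite V
  exact ⟨Finset.univ.sup n + 1, fun o ↦
    ⟨f o, hf o, (hn o).mono (Finset.le_sup (Finset.mem_univ o))⟩⟩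

open Classical in
/-- The cops' update of (rounds left, own positions, possible robber positions) after an
observation. -/
noncomputable def updateBelief (G : SimpleGraph V) (vis : (Fin d → V) → V → Prop) (o : Option V)
    (s : ℕ × (Fin d → V) × Set V) : ℕ × (Fin d → V) × Set V :=
  if h : ∃ c' : Fin d → V, (∀ i, c' i = s.2.1 i ∨ G.Adj (s.2.1 i) (c' i)) ∧
      WinsWithin G vis (s.1 - 1) c' (nextPositions G c' {r ∈ s.2.2 | observe vis s.2.1 r = o}) then
    (s.1 - 1, h.choose, nextPositions G h.choose {r ∈ s.2.2 | observe vis s.2.1 r = o})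
  else s

open Classical in
/-- The cop strategy starting at `c` that follows the belief updates, knowing initially that the
robber is not at a cop's position. -/
noncomputable def beliefStrategy (G : SimpleGraph V) (vis : (Fin d → V) → V → Prop) (n : ℕ)
    (c : Fin d → V) : CopStrategy V d where
  init := c
  move h p i :=
    let t := (h.foldr (updateBelief G vis) (n, c, {r | ∀ i, c i ≠ r})).2.1 i
    if t = p i ∨ G.Adj (p i) t then t else p i

lemma beliefStrategy_legal (n : ℕ) (c : Fin d → V) : (beliefStrategy G vis n c).Legal G := by
  intro h p i
  simp only [beliefStrategy]
  split_ifs with h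
  · exact h
  · exact .inl rfl

/-- As long as the robber is not caught, the belief strategy keeps track of him. -/
lemma beliefStrategy_invariant {n : ℕ} {c : Fin d → V}
    (hw : WinsWithin G vis n c {r | ∀ i, c i ≠ r}) {R : RobberStrategy V d} (hR : R.Legal G)
    (hcap : ¬ Captures vis (beliefStrategy G vis n c) R) (m : ℕ) (hm : m ≤ n) :
    ∃ B : Set V,
      (play vis (beliefStrategy G vis n c) R m).2.1.foldr (updateBelief G vis)
        (n, c, {r | ∀ i, c i ≠ r}) = (n - m, copPos vis (beliefStrategy G vis n c) R m, B) ∧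
      robPos vis (beliefStrategy G vis n c) R m ∈ B ∧
      WinsWithin G vis (n - m) (copPos vis (beliefStrategy G vis n c) R m) B := by
  simp only [Captures, not_exists, not_or] at hcap
  induction m with
  | zero => exact ⟨_, rfl, fun i ↦ (hcap 0 i).1, hw⟩
  | succ m ih =>
    obtain ⟨B, hs, hr, hB⟩ := ih (by omega)
    set S := beliefStrategy G vis n c with hS
    set o := observe vis (copPos vis S R m) (robPos vis S R m)
    obtain ⟨j, hj⟩ : ∃ j, n - m = j + 1 := ⟨n - m - 1, by omega⟩
    have hex : ∃ c' : Fin d → V, (∀ i, c' i = copPos vis S R m i ∨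
        G.Adj (copPos vis S R m i) (c' i)) ∧ WinsWithin G vis (n - m - 1) c'
          (nextPositions G c' {r ∈ B | observe vis (copPos vis S R m) r = o}) := by
      rw [hj] at hB ⊢
      exact hB o
    have hobs : (play vis S R (m + 1)).2.1 = o :: (play vis S R m).2.1 := rfl
    have hupd : (play vis S R (m + 1)).2.1.foldr (updateBelief G vis)
        (n, c, {r | ∀ i, c i ≠ r}) = (n - m - 1, hex.choose,
          nextPositions G hex.choose {r ∈ B | observe vis (copPos vis S R m) r = o}) := by
      rw [hobs, List.foldr_cons, hs]
      exact dif_pos hex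
    have hcop : copPos vis S R (m + 1) = hex.choose := by
      have hmove : copPos vis S R (m + 1) =
          S.move (play vis S R (m + 1)).2.1 (copPos vis S R m) := rfl
      rw [hmove]
      funext i
      simp only [hS, beliefStrategy] at hupd hex ⊢
      rw [hupd]
      exact if_pos (hex.choose_spec.1 i)
    refine ⟨nextPositions G hex.choose {r ∈ B | observe vis (copPos vis S R m) r = o},
      ?_, ?_, ?_⟩
    · rw [hupd, hcop]
      exact Prod.ext (Nat.sub_sub n m 1) rfl
    · refine ⟨fun i ↦ hcop ▸ (hcap (m + 1) i).1, _, ⟨hr, rfl⟩,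
        fun i ↦ hcop ▸ (hcap m i).2, hR _ _ _⟩
    · rw [hcop, ← Nat.sub_sub]
      exact hex.choose_spec.2

theorem Wins.exists_winningCopStrategy {c : Fin d → V}
    (hw : Wins G vis c {r | ∀ i, c i ≠ r}) : ∃ S, WinningCopStrategy G vis S := by
  obtain ⟨n, hn⟩ := hw
  refine ⟨beliefStrategy G vis n c, beliefStrategy_legal n c, fun R hR ↦ ?_⟩
  by_contra hcap
  obtain ⟨B, -, hr, hB⟩ := beliefStrategy_invariant hn hR hcap n le_rfl
  rw [Nat.sub_self] at hB
  rw [show B = ∅ from hB] at hr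
  exact hr

end Belief

/-! ### Branches of a tree -/

section Branch

variable {V : Type} {T : SimpleGraph V} {a b c z z' : V}

/-- The vertices closer to `b` than to `a`; in a tree with an edge `ab`, this is the component
of `b` after deleting that edge. -/
def branch (T : SimpleGraph V) (a b : V) : Set V := {z | T.dist z b < T.dist z a}

lemma notMem_branch_left : a ∉ branch T a b := by simp [branch]

lemma notMem_branch_symm (h : z ∈ branch T a b) : z ∉ branch T b a :=
  fun h' ↦ lt_asymm (show T.dist z b < T.dist z a from h) h'

lemma mem_branch_of_notMem (hT : T.IsTree) (hab : T.Adj a b) (h : z ∉ branch T a b) :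
    z ∈ branch T b a :=
  lt_of_le_of_ne (not_lt.1 h) (hT.dist_ne_of_adj z hab)

lemma mem_branch_of_adj (hab : T.Adj a b) : b ∈ branch T a b := by
  simp [branch, dist_eq_one_iff_adj.2 hab.symm]

lemma exists_adj_mem_branch (hT : T.IsTree) (hne : z ≠ a) : ∃ b, T.Adj a b ∧ z ∈ branch T a b := by
  obtain ⟨p, hp⟩ := hT.connected.exists_walk_length_eq_dist a z
  cases p with
  | nil => exact absurd rfl hne
  | @cons _ b _ h q =>
    refine ⟨b, h, ?_⟩
    have := T.dist_le q
    rw [Walk.length_cons] at hp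
    simp only [branch, Set.mem_ofPred_eq, dist_comm (u := z)]
    omega

/-- In a tree, the neighbour in the direction of another vertex is unique. -/
lemma eq_of_mem_branch (hT : T.IsTree) (hb : T.Adj a b) (hc : T.Adj a c)
    (hzb : z ∈ branch T a b) (hzc : z ∈ branch T a c) : b = c := by
  have key : ∀ {u : V}, T.Adj a u → z ∈ branch T a u →
      ∃ p : T.Walk a z, p.IsPath ∧ p.snd = u := by
    intro u hu hz
    obtain ⟨q, hq⟩ := hT.connected.exists_walk_length_eq_dist u z
    refine ⟨.cons hu q, Walk.isPath_of_length_eq_dist _ ?_, Walk.snd_cons q hu⟩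
    have hd := hT.dist_eq_dist_add_one_of_adj z hu
    simp only [branch, Set.mem_ofPred_eq] at hz
    rw [Walk.length_cons, hq, dist_comm, dist_comm (u := a)]
    omega
  obtain ⟨p, hp, rfl⟩ := key hb hzb
  obtain ⟨q, hq, rfl⟩ := key hc hzc
  rw [(hT.existsUnique_path a z).unique hp hq]

/-- The edge `ab` is the only one leaving the branch at `b` away from `a`. -/
lemma eq_of_adj_of_notMem_branch (hT : T.IsTree) (hab : T.Adj a b) (hz : z ∈ branch T a b)
    (hz' : z' ∉ branch T a b) (h : T.Adj z z') : z = b ∧ z' = a := by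
  have hz'' := mem_branch_of_notMem hT hab hz'
  have h₁ := hT.dist_eq_dist_add_one_of_adj z hab
  have h₂ := hT.dist_eq_dist_add_one_of_adj z' hab
  have h₃ := hT.dist_eq_dist_add_one_of_adj a h
  have h₄ := hT.dist_eq_dist_add_one_of_adj b h
  simp only [branch, Set.mem_ofPred_eq, dist_comm (v := a), dist_comm (v := b)] at *
  by_cases hzb : z = b
  · subst hzb
    rw [dist_self] at *
    exact ⟨rfl, ((hT.connected.dist_eq_zero_iff).1 (by omega : T.dist a z' = 0)).symm⟩
  · exfalso
    obtain ⟨y, hy, hby⟩ := exists_adj_mem_branch hT (Ne.symm hzb)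
    have h₅ := hT.dist_eq_dist_add_one_of_adj a hy
    have h₆ := hT.connected.dist_triangle (u := a) (v := b) (w := y)
    rw [dist_eq_one_iff_adj.2 hab] at h₆
    simp only [branch, Set.mem_ofPred_eq] at hby
    have hyz : y = z' := eq_of_mem_branch (z := a) hT hy h
      (by simp only [branch, Set.mem_ofPred_eq]; omega)
      (by simp only [branch, Set.mem_ofPred_eq]; omega)
    subst hyz
    omega

lemma mem_branch_of_adj_of_ne (hT : T.IsTree) (hab : T.Adj a b) (hz : z ∈ branch T a b)
    (h : z' = z ∨ T.Adj z z') (hne : z' ≠ a) : z' ∈ branch T a b := by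
  by_contra hz'
  rcases h with rfl | h
  · exact hz' hz
  · exact hne (eq_of_adj_of_notMem_branch hT hab hz hz' h).2

lemma branch_subset_branch (hT : T.IsTree) (hab : T.Adj a b) (hbc : T.Adj b c) (hca : c ≠ a) :
    branch T b c ⊆ branch T a b := by
  intro z hz
  by_contra h
  exact hca (eq_of_mem_branch hT hbc hab.symm hz (mem_branch_of_notMem hT hab h))

lemma dist_add_one_add_dist_le (hT : T.IsTree) (hab : T.Adj a b) (hz : z ∈ branch T a b)
    {x : V} (hx : x ∉ branch T a b) : T.dist z b + 1 + T.dist a x ≤ T.dist z x := by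
  obtain ⟨p, hp⟩ := hT.connected.exists_walk_length_eq_dist z x
  rw [← hp]
  clear hp
  induction p with
  | nil => exact absurd hz hx
  | @cons u v w h p ih =>
    rw [Walk.length_cons]
    by_cases hv : v ∈ branch T a b
    · have h₁ := ih hv hx
      have h₂ := hT.connected.dist_triangle (u := u) (v := v) (w := b)
      rw [dist_eq_one_iff_adj.2 h] at h₂
      omega
    · obtain ⟨rfl, rfl⟩ := eq_of_adj_of_notMem_branch hT hab hz hv h
      have := T.dist_le p
      rw [dist_self]
      omega

/-- A geodesic has an edge splitting it at any prescribed place. -/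
lemma exists_adj_mem_branch_dist_eq (hG : T.Connected) {x y : V} :
    ∀ i : ℕ, i < T.dist x y → ∃ a b, T.Adj a b ∧ T.dist x a = i ∧
      T.dist b y + (i + 1) = T.dist x y ∧ x ∈ branch T b a ∧ y ∈ branch T a b := by
  intro i hi
  obtain ⟨p, hp⟩ := hG.exists_walk_length_eq_dist x y
  refine ⟨p.getVert i, p.getVert (i + 1), p.adj_getVert_succ (by omega), ?_⟩
  have h₁ := T.dist_le (p.take i)
  have h₂ := T.dist_le (p.drop (i + 1))
  have h₃ := hG.dist_triangle (u := x) (v := p.getVert i) (w := y)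
  have h₄ := hG.dist_triangle (u := p.getVert i) (v := p.getVert (i + 1)) (w := y)
  have h₅ := hG.dist_triangle (u := x) (v := p.getVert (i + 1)) (w := y)
  rw [dist_eq_one_iff_adj.2 (p.adj_getVert_succ (by omega))] at h₄
  rw [Walk.take_length] at h₁
  rw [Walk.drop_length] at h₂
  simp only [branch, Set.mem_ofPred_eq, dist_comm (u := y)]
  omega

end Branch

/-! ### One searching cop -/

section Search

variable {V : Type} {T : SimpleGraph V} {vis : (Fin 3 → V) → V → Prop} {x y a b c c' : V}

/-- The positions a robber avoiding `c` can reach from `A` in one round. -/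
def evade (T : SimpleGraph V) (c : V) (A : Set V) : Set V :=
  {r' | r' ≠ c ∧ ∃ r ∈ A, r ≠ c ∧ (r' = r ∨ T.Adj r r')}

lemma nextPositions_subset_evade (A : Set V) : nextPositions T ![x, y, c] A ⊆ evade T c A :=
  fun _ ⟨h₁, r, hr, h₂, h₃⟩ ↦ ⟨(h₁ 2).symm, r, hr, (h₂ 2).symm, h₃⟩

lemma evade_mono {A B : Set V} (h : A ⊆ B) : evade T c A ⊆ evade T c B :=
  fun _ ⟨h₁, r, hr, h₂⟩ ↦ ⟨h₁, r, h hr, h₂⟩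

lemma evade_subset_branch (hT : T.IsTree) (hab : T.Adj a b) {A : Set V} (hA : A ⊆ branch T a b) :
    evade T a A ⊆ branch T a b := by
  rintro r' ⟨hne, r, hr, -, h⟩
  exact mem_branch_of_adj_of_ne hT hab (hA hr) h hne

lemma evade_subset_branch_diff (hT : T.IsTree) (hab : T.Adj a b) {A : Set V}
    (hA : A ⊆ branch T a b) : evade T b A ⊆ branch T a b \ {b} := by
  rintro r' ⟨hne, r, hr, hrb, h⟩
  refine ⟨?_, hne⟩
  by_contra hr'
  rcases h with rfl | h
  · exact hr' (hA hr)
  · exact hrb (eq_of_adj_of_notMem_branch hT hab (hA hr) hr' h).1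

/-- The vertices other than `a` outside the branches at `a` towards the elements of `L`. -/
def uncleared (T : SimpleGraph V) (a : V) (L : Set V) : Set V :=
  {z | z ≠ a ∧ ∀ u ∈ L, z ∉ branch T a u}

lemma evade_uncleared_subset (hT : T.IsTree) {L : Set V} (hL : ∀ u ∈ L, T.Adj a u) {A : Set V}
    (hA : A ⊆ insert a (uncleared T a L)) : evade T a A ⊆ uncleared T a L := by
  rintro r' ⟨hne, r, hr, hra, h⟩
  refine ⟨hne, fun u hu hr' ↦ ?_⟩
  obtain rfl | hr := hA hr
  · exact hra rfl
  · exact hr.2 u hu (mem_branch_of_adj_of_ne hT (hL u hu) hr' (h.imp Eq.symm Adj.symm) hra)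

/-- A robber at distance at least two from both `a` and `b` is seen as long as the first two cops
stand at `x` and `y`. -/
def VisibleAwayFrom (T : SimpleGraph V) (vis : (Fin 3 → V) → V → Prop) (x y a b : V) : Prop :=
  ∀ c r, r ≠ a → r ≠ b → ¬ T.Adj a r → ¬ T.Adj b r → vis ![x, y, c] r

lemma VisibleAwayFrom.symm (h : VisibleAwayFrom T vis x y a b) : VisibleAwayFrom T vis x y b a :=
  fun c r h₁ h₂ h₃ h₄ ↦ h c r h₂ h₁ h₄ h₃

variable [Finite V]

lemma wins_of_observation {B : Set V}
    (hv : ∀ r ∈ B, vis ![x, y, c] r → ∃ c', T.Adj c c' ∧ Wins T vis ![x, y, c'] (evade T c' {r}))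
    (hi : ∃ c', T.Adj c c' ∧ Wins T vis ![x, y, c'] (evade T c' {r ∈ B | ¬ vis ![x, y, c] r})) :
    Wins T vis ![x, y, c] B := by
  have legal : ∀ {c'}, T.Adj c c' → ∀ i, ![x, y, c'] i = ![x, y, c] i ∨
      T.Adj (![x, y, c] i) (![x, y, c'] i) := by
    intro c' h i
    fin_cases i
    · exact .inl rfl
    · exact .inl rfl
    · exact .inr h
  refine wins_of_forall_observation fun o ↦ ?_
  by_cases ho : ∃ r ∈ B, vis ![x, y, c] r ∧ o = some r
  · obtain ⟨r, hr, hvr, rfl⟩ := ho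
    obtain ⟨c', hc, hw⟩ := hv r hr hvr
    refine ⟨_, legal hc, hw.anti ((nextPositions_mono ?_).trans (nextPositions_subset_evade _))⟩
    rintro s ⟨-, hs⟩
    unfold observe at hs
    split_ifs at hs
    simpa using hs
  · obtain ⟨c', hc, hw⟩ := hi
    refine ⟨_, legal hc, hw.anti ((nextPositions_mono ?_).trans (nextPositions_subset_evade _))⟩
    rintro s ⟨hs, hso⟩
    refine ⟨hs, fun hvs ↦ ho ⟨s, hs, hvs, ?_⟩⟩
    rw [← hso, observe, if_pos hvs]

lemma wins_of_adj {B : Set V} (h : T.Adj c c') (hw : Wins T vis ![x, y, c'] (evade T c' B)) :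
    Wins T vis ![x, y, c] B :=
  wins_of_observation
    (fun _ hr _ ↦ ⟨c', h, hw.anti (evade_mono (Set.singleton_subset_iff.2 hr))⟩)
    ⟨c', h, hw.anti (evade_mono fun _ hr ↦ hr.1)⟩

/-- A cop who has entered a branch in which the robber stays visible catches him. -/
lemma wins_chase (hT : T.IsTree) (hab : T.Adj a b)
    (hvis : ∀ c, ∀ r ∈ branch T a b \ {b}, vis ![x, y, c] r) :
    Wins T vis ![x, y, b] (branch T a b \ {b}) := by
  induction hn : (branch T a b).ncard using Nat.strong_induction_on generalizing a b with
  | _ n ih =>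
  subst hn
  refine wins_of_observation (fun r hr _ ↦ ?_) ⟨a, hab.symm, (wins_empty _).anti ?_⟩
  · obtain ⟨c, hbc, hrc⟩ := exists_adj_mem_branch hT hr.2
    have hca : c ≠ a := by
      rintro rfl
      exact notMem_branch_symm hr.1 hrc
    have hsub := branch_subset_branch hT hab hbc hca
    have hlt : (branch T b c).ncard < (branch T a b).ncard :=
      Set.ncard_lt_ncard ⟨hsub, fun h ↦ notMem_branch_left (h (mem_branch_of_adj hab))⟩
        (Set.toFinite _)
    refine ⟨c, hbc, (ih _ hlt hbc (fun d s hs ↦ hvis d s ⟨hsub hs.1, ?_⟩) rfl).anti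
      (evade_subset_branch_diff hT hbc (Set.singleton_subset_iff.2 hrc))⟩
    rintro rfl
    exact notMem_branch_left hs.1
  · rintro r' ⟨-, r, hr, -⟩
    exact hr.2 (hvis b r hr.1)

/-- A cop at an endpoint `a` of the edge `ab` catches a robber known to be in a given branch at
`a` other than that of `b`, provided that the robber is visible away from the neighbourhood of
the edge. -/
lemma wins_enter_branch (hT : T.IsTree) (hab : T.Adj a b)
    (hvis : VisibleAwayFrom T vis x y a b) {u : V} (hu : T.Adj a u) (hub : u ≠ b) :
    Wins T vis ![x, y, u] (branch T a u \ {u}) := by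
  refine wins_chase hT hu fun c r hr ↦ ?_
  have hb : b ∉ branch T a u := fun h ↦ hub (eq_of_mem_branch hT hu hab h (mem_branch_of_adj hab))
  refine hvis c r ?_ ?_ (fun h ↦ ?_) (fun h ↦ ?_)
  · rintro rfl
    exact notMem_branch_left hr.1
  · rintro rfl
    exact hb hr.1
  · exact hr.2 (eq_of_adj_of_notMem_branch hT hu hr.1 notMem_branch_left h.symm).1
  · exact hr.2 (eq_of_adj_of_notMem_branch hT hu hr.1 hb h.symm).1

/-- A cop at an endpoint of the edge `ab` wins as soon as he sees the robber. -/
lemma wins_of_seen (hT : T.IsTree) (hab : T.Adj a b)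
    (hvis : VisibleAwayFrom T vis x y a b) {r : V} (hr : r ≠ a) :
    ∃ c', T.Adj a c' ∧ Wins T vis ![x, y, c'] (evade T c' {r}) := by
  obtain ⟨u, hu, hru⟩ := exists_adj_mem_branch hT hr
  by_cases hub : u = b
  · subst hub
    refine ⟨u, hu, ?_⟩
    by_cases hr' : r = u
    · refine (wins_empty _).anti ?_
      rintro _ ⟨-, s, hs, hsu, -⟩
      exact hsu (hs.trans hr')
    · obtain ⟨w, hw, hrw⟩ := exists_adj_mem_branch hT hr'
      have hwa : w ≠ a := by
        rintro rfl
        exact notMem_branch_symm hru hrw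
      refine wins_of_adj hw ((wins_enter_branch hT hab.symm hvis.symm hw hwa).anti ?_)
      exact evade_subset_branch_diff hT hw
        (evade_subset_branch hT hw (Set.singleton_subset_iff.2 hrw))
  · exact ⟨u, hu, (wins_enter_branch hT hab hvis hu hub).anti
      (evade_subset_branch_diff hT hu (Set.singleton_subset_iff.2 hru))⟩

/-- A cop at an endpoint `a` of the edge `ab` can clear one more branch at `a`. -/
lemma wins_check_neighbor (hT : T.IsTree) (hab : T.Adj a b)
    (hvis : VisibleAwayFrom T vis x y a b) {L : Set V} (hL : ∀ u ∈ L, T.Adj a u) {u : V}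
    (hu : T.Adj a u) (hub : u ≠ b) (hw : Wins T vis ![x, y, a] (uncleared T a (insert u L))) :
    Wins T vis ![x, y, a] (uncleared T a L) := by
  refine wins_of_observation (fun r hr _ ↦ wins_of_seen hT hab hvis hr.1) ⟨u, hu, ?_⟩
  refine wins_of_adj hu.symm (hw.anti (evade_uncleared_subset hT ?_ ?_))
  · rintro w (rfl | hw)
    exacts [hu, hL w hw]
  · rintro r' ⟨-, r, ⟨hr, hinv⟩, hru, h⟩
    by_cases hra : r' = a
    · exact .inl hra
    refine .inr ⟨hra, fun w hw hr' ↦ ?_⟩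
    have hwa : T.Adj a w := by
      obtain rfl | hw := hw
      exacts [hu, hL w hw]
    have hrw : r ∈ branch T a w :=
      mem_branch_of_adj_of_ne hT hwa hr' (h.imp Eq.symm Adj.symm) hr.1
    obtain rfl | hw := hw
    · refine hinv (hvis a r hr.1 ?_ (fun har ↦ ?_) (fun hbr ↦ ?_))
      · rintro rfl
        exact hub (eq_of_mem_branch hT hu hab hrw (mem_branch_of_adj hab))
      · exact hru (eq_of_adj_of_notMem_branch hT hu hrw notMem_branch_left har.symm).1
      · exact hru (eq_of_adj_of_notMem_branch hT hu hrw
          (fun h ↦ hub (eq_of_mem_branch hT hu hab h (mem_branch_of_adj hab))) hbr.symm).1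
    · exact hr.2 w hw hrw

lemma wins_check_neighbors (hT : T.IsTree) (hab : T.Adj a b)
    (hvis : VisibleAwayFrom T vis x y a b) {L : Set V} (hL : ∀ u ∈ L, T.Adj a u) (M : Finset V)
    (hM : ∀ u ∈ M, T.Adj a u ∧ u ≠ b)
    (hw : Wins T vis ![x, y, a] (uncleared T a (L ∪ M))) :
    Wins T vis ![x, y, a] (uncleared T a L) := by
  classical
  induction M using Finset.induction_on generalizing L with
  | empty => simpa using hw
  | insert u M _ ih =>
    have hu := hM u (Finset.mem_insert_self u M)
    refine wins_check_neighbor hT hab hvis hL hu.1 hu.2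
      (ih ?_ (fun w hw ↦ hM w (Finset.mem_insert_of_mem hw)) ?_)
    · rintro w (rfl | hw)
      exacts [hu.1, hL w hw]
    · rwa [Set.insert_union, ← Set.union_insert, ← Finset.coe_insert]

/-- If the robber is visible away from the neighbourhood of an edge `ab`, then a single cop
starting at `a` catches him. -/
theorem wins_of_visible_away_from_edge (hT : T.IsTree) (hab : T.Adj a b)
    (hvis : VisibleAwayFrom T vis x y a b) : Wins T vis ![x, y, a] {r | r ≠ a} := by
  have hfin (s : Set V) : s.Finite := s.toFinite
  have hb : Wins T vis ![x, y, b] (uncleared T b {a}) := by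
    refine wins_check_neighbors hT hab.symm hvis.symm (by rintro u rfl; exact hab.symm)
      (hfin {u | T.Adj b u ∧ u ≠ a}).toFinset (by simp) ((wins_empty _).anti ?_)
    rintro z ⟨hz, h⟩
    obtain ⟨u, hu, hzu⟩ := exists_adj_mem_branch hT hz
    refine h u ?_ hzu
    by_cases hua : u = a
    · exact .inl hua
    · exact .inr (by simpa using ⟨hu, hua⟩)
  have ha : Wins T vis ![x, y, a] (uncleared T a ∅) := by
    refine wins_check_neighbors hT hab hvis (by simp)
      (hfin {u | T.Adj a u ∧ u ≠ b}).toFinset (by simp) (wins_of_adj hab (hb.anti ?_))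
    refine (evade_subset_branch_diff hT hab ?_).trans ?_
    · rintro z ⟨hz, h⟩
      obtain ⟨u, hu, hzu⟩ := exists_adj_mem_branch hT hz
      by_cases hub : u = b
      · exact hub ▸ hzu
      · exact absurd hzu (h u (.inr (by simpa using ⟨hu, hub⟩)))
    · rintro z ⟨hz, hne⟩
      exact ⟨hne, by rintro u rfl; exact notMem_branch_symm hz⟩
  exact ha.anti fun z hz ↦ ⟨hz, by simp⟩

end Search

/-- If `k ≥ 2` and `T` is a finite tree with `2k - 3 ≤ diam(T) ≤ 2k - 2`, then
`c_{H,k}(T) ≤ 3`. -/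
theorem stmt18 {V : Type} [Fintype V] (T : SimpleGraph V) (hT : T.IsTree)
    (k : ℕ) (hk : 2 ≤ k) (hd1 : 2 * k - 3 ≤ T.diam) (hd2 : T.diam ≤ 2 * k - 2) :
    hyperopicCopNumber T k ≤ 3 := by
  have := hT.connected.nonempty
  obtain ⟨x, y, hxy⟩ := T.exists_dist_eq_diam
  obtain ⟨a, b, hab, hxa, hby, hx, hy⟩ :=
    exists_adj_mem_branch_dist_eq hT.connected (x := x) (y := y) (k - 2) (by omega)
  refine Nat.sInf_le ?_
  refine Wins.exists_winningCopStrategy (c := ![x, y, a])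
    ((wins_of_visible_away_from_edge hT hab ?_).anti fun r hr ↦ (hr 2).symm)
  intro c r hra hrb har hbr hinv
  have hx' := (hinv 0).2
  have hy' := (hinv 1).2
  simp only [Matrix.cons_val_zero, Matrix.cons_val_one] at hx' hy'
  by_cases hr : r ∈ branch T a b
  · have h₁ := dist_add_one_add_dist_le hT hab hr (notMem_branch_symm hx)
    have h₂ := (hT.connected r b).one_lt_dist_of_ne_of_not_adj hrb fun h ↦ hbr h.symm
    rw [dist_comm (u := a)] at h₁
    omega
  · have h₁ := dist_add_one_add_dist_le hT hab.symm (mem_branch_of_notMem hT hab hr)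
      (notMem_branch_symm hy)
    have h₂ := (hT.connected r a).one_lt_dist_of_ne_of_not_adj hra fun h ↦ har h.symm
    omega

end CopsRobber
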